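/- Let G be a 2-connected finite simple graph. If min{ max{d_G(x), d_G(y)} : x, y ∈ V(G) with d(x,y) = 2 } ≥ α̃(G), i.e., for every pair of vertices x, y at distance exactly 2 in G at least one of x, y has degree at least α̃(G), then G is hamiltonian. -/

import Mathlib

/-- An `(s,t)`-bipartite-hole in a graph `G` consists of two disjoint sets of vertices
`S` and `T` with `|S| = s` and `|T| = t` such that `G` has no edge between `S` and `T`. -/
def SimpleGraph.HasBipartiteHole {V : Type*} (G : SimpleGraph V) (s t : ℕ) : Prop :=
  ∃ S T : Finset V, Disjoint S T ∧ S.card = s ∧ T.card = t ∧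
    ∀ a ∈ S, ∀ b ∈ T, ¬ G.Adj a b

/-- The bipartite-hole-number `α̃(G)`: the minimum integer `k` such that there exist positive
integers `s` and `t` with `s + t = k + 1` for which `G` contains no `(s,t)`-bipartite-hole. -/
noncomputable def SimpleGraph.bipartiteHoleNumber {V : Type*} (G : SimpleGraph V) : ℕ :=
  sInf {k : ℕ | ∃ s t : ℕ, 0 < s ∧ 0 < t ∧ s + t = k + 1 ∧ ¬ G.HasBipartiteHole s t}

/-- A graph is 2-connected if it has at least 3 vertices and remains connected after deleting
any single vertex. -/
def SimpleGraph.TwoConnected {V : Type*} [Fintype V] (G : SimpleGraph V) : Prop :=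
  3 ≤ Fintype.card V ∧ ∀ v : V, (G.induce {u | u ≠ v}).Connected

namespace SimpleGraph

variable {V : Type*}

/-- The list `l` enumerates the vertices of a Hamiltonian path of `H`. -/
structure IsSpanningPath (H : SimpleGraph V) (l : List V) : Prop where
  isChain : l.IsChain H.Adj
  nodup : l.Nodup
  mem : ∀ v, v ∈ l

/-- The list `l` enumerates the vertices of a Hamiltonian cycle of `H`. -/
structure IsSpanningCycle (H : SimpleGraph V) (l : List V) : Prop extends
    IsSpanningPath H l where
  closes : ∀ x ∈ l.getLast?, ∀ y ∈ l.head?, H.Adj x y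

lemma IsSpanningPath.length_eq [Fintype V] {H : SimpleGraph V} {l : List V}
    (h : H.IsSpanningPath l) : l.length = Fintype.card V := by
  classical
  rw [← List.toFinset_card_of_nodup h.nodup, ← Finset.card_univ]
  congr 1
  ext v
  simp [h.mem v]

lemma IsSpanningCycle.isHamiltonian [Fintype V] [DecidableEq V] {H : SimpleGraph V} {l : List V}
    (hl : H.IsSpanningCycle l) (hV : 3 ≤ Fintype.card V) : H.IsHamiltonian := by
  intro _
  have hlen := hl.length_eq
  have hne : l ≠ [] := by
    rintro rfl
    simp at hlen
    omega
  have hadj : H.Adj (l.getLast hne) (l.head hne) :=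
    hl.closes _ (by simp [List.getLast?_eq_some_getLast hne]) _
      (by simp [List.head?_eq_some_head hne])
  refine ⟨_, .cons hadj (.ofSupport l hne hl.isChain), ?_⟩
  rw [Walk.isHamiltonianCycle_iff_isCycle_and_length_eq,
    Walk.isCycle_iff_isPath_tail_and_le_length]
  refine ⟨⟨?_, ?_⟩, ?_⟩
  · rw [Walk.isPath_def]
    simpa using hl.nodup
  · simp
    omega
  · simp
    omega

lemma HasBipartiteHole.anti {G H : SimpleGraph V} (h : G ≤ H) {s t : ℕ}
    (hH : H.HasBipartiteHole s t) : G.HasBipartiteHole s t := by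
  obtain ⟨S, T, hd, hs, ht, hST⟩ := hH
  exact ⟨S, T, hd, hs, ht, fun a ha b hb hab => hST a ha b hb (h hab)⟩

lemma HasBipartiteHole.of_le_card {G : SimpleGraph V} {s t : ℕ} {S T : Finset V}
    (hd : Disjoint S T) (hs : s ≤ S.card) (ht : t ≤ T.card)
    (h : ∀ a ∈ S, ∀ b ∈ T, ¬ G.Adj a b) : G.HasBipartiteHole s t := by
  obtain ⟨S', hS', rfl⟩ := Finset.exists_subset_card_eq hs
  obtain ⟨T', hT', rfl⟩ := Finset.exists_subset_card_eq ht
  exact ⟨S', T', Finset.disjoint_of_subset_left hS' (Finset.disjoint_of_subset_right hT' hd),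
    rfl, rfl, fun a ha b hb => h a (hS' ha) b (hT' hb)⟩

lemma exists_not_hasBipartiteHole [Fintype V] (G : SimpleGraph V) :
    ∃ s t : ℕ, 0 < s ∧ 0 < t ∧ s + t = G.bipartiteHoleNumber + 1 ∧ ¬ G.HasBipartiteHole s t := by
  refine Nat.sInf_mem (s := {k : ℕ | ∃ s t : ℕ, 0 < s ∧ 0 < t ∧ s + t = k + 1 ∧
    ¬ G.HasBipartiteHole s t})
    ⟨Fintype.card V + 1, Fintype.card V + 1, 1, by omega, by omega, by omega, ?_⟩
  rintro ⟨S, T, _, hs, _⟩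
  have := S.card_le_univ
  omega

section Rotation

variable {H : SimpleGraph V} {P Q R : List V}

lemma IsSpanningPath.reverse_append_append_reverse (h : H.IsSpanningPath (P ++ (Q ++ R)))
    (hQ : Q ≠ [])
    (h₁ : ∀ p ∈ P.head?, ∀ q ∈ Q.head?, H.Adj p q)
    (h₂ : ∀ q ∈ Q.getLast?, ∀ r ∈ R.getLast?, H.Adj q r)
    (h₃ : ∀ p ∈ P.getLast?, ∀ r ∈ R.head?, H.Adj p r) (hP : P ≠ []) (hR : R ≠ []) :
    H.IsSpanningCycle (P.reverse ++ (Q ++ R.reverse)) := by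
  obtain ⟨hc, hn, hm⟩ := h
  rw [List.isChain_append, List.isChain_append] at hc
  refine ⟨⟨?_, ?_, ?_⟩, ?_⟩
  · rw [List.isChain_append, List.isChain_append, List.isChain_reverse, List.isChain_reverse]
    refine ⟨hc.1.imp fun _ _ h => h.symm, ⟨hc.2.1.1, hc.2.1.2.1.imp fun _ _ h => h.symm, ?_⟩, ?_⟩
    · simpa using h₂
    · simpa [List.head?_append_of_ne_nil _ hQ] using h₁
  · refine (List.Perm.nodup_iff ?_).1 hn
    exact (List.reverse_perm P).symm.append ((List.reverse_perm R).symm.append_left Q)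
  · intro v
    simpa using hm v
  · intro x hx y hy
    have hR' : R.reverse ≠ [] := by simpa using hR
    have hP' : P.reverse ≠ [] := by simpa using hP
    rw [← List.append_assoc, List.getLast?_append_of_ne_nil _ hR', List.getLast?_reverse] at hx
    rw [List.head?_append_of_ne_nil _ hP', List.head?_reverse] at hy
    exact (h₃ y hy x hx).symm

lemma IsSpanningPath.append_reverse_append (h : H.IsSpanningPath (P ++ (Q ++ R)))
    (h₁ : ∀ p ∈ P.getLast?, ∀ r ∈ R.getLast?, H.Adj p r)
    (h₂ : ∀ r ∈ R.head?, ∀ q ∈ Q.head?, H.Adj r q)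
    (h₃ : ∀ q ∈ Q.getLast?, ∀ p ∈ P.head?, H.Adj q p)
    (hP : P ≠ []) (hQ : Q ≠ []) (hR : R ≠ []) :
    H.IsSpanningCycle (P ++ (R.reverse ++ Q)) := by
  obtain ⟨hc, hn, hm⟩ := h
  rw [List.isChain_append, List.isChain_append] at hc
  have hR' : R.reverse ≠ [] := by simpa using hR
  refine ⟨⟨?_, ?_, ?_⟩, ?_⟩
  · rw [List.isChain_append, List.isChain_append, List.isChain_reverse]
    refine ⟨hc.1, ⟨hc.2.1.2.1.imp fun _ _ h => h.symm, hc.2.1.1, ?_⟩, ?_⟩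
    · simpa using h₂
    · simpa [List.head?_append_of_ne_nil _ hR'] using h₁
  · refine (List.Perm.nodup_iff ?_).1 hn
    exact (List.perm_append_comm.trans ((List.reverse_perm R).symm.append_right Q)).append_left P
  · intro v
    simpa [or_comm, or_left_comm] using hm v
  · intro x hx y hy
    rw [← List.append_assoc, List.getLast?_append_of_ne_nil _ hQ] at hx
    rw [List.head?_append_of_ne_nil _ hP] at hy
    exact h₃ x hx y hy

lemma IsSpanningPath.exists_isSpanningCycle_of_le {l : List V} (h : H.IsSpanningPath l) {a b : ℕ}
    (ha : 1 ≤ a) (hab : a ≤ b) (hb : b + 1 < l.length) (h₁ : H.Adj l[0] l[a])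
    (h₂ : H.Adj l[l.length - 1] l[b]) (h₃ : H.Adj l[a - 1] l[b + 1]) :
    ∃ l', H.IsSpanningCycle l' := by
  have hl : l = l.take a ++ ((l.drop a).take (b + 1 - a) ++ l.drop (b + 1)) := by
    have : l.drop (b + 1) = (l.drop a).drop (b + 1 - a) := by
      rw [List.drop_drop]; congr 1; omega
    rw [this, List.take_append_drop, List.take_append_drop]
  have h' := h
  rw [hl] at h'
  have e₁ : (l.take a).head? = some l[0] := by
    rw [List.head?_take, if_neg (by omega), List.head?_eq_getElem?, List.getElem?_eq_getElem]
  have e₂ : (l.take a).getLast? = some l[a - 1] := by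
    rw [List.getLast?_eq_getElem?, List.getElem?_eq_some_iff]
    refine ⟨by simp; omega, ?_⟩
    simp only [List.getElem_take, List.length_take]
    congr 1; omega
  have e₃ : ((l.drop a).take (b + 1 - a)).head? = some l[a] := by
    simp [List.head?_take, List.head?_drop]
    omega
  have e₄ : ((l.drop a).take (b + 1 - a)).getLast? = some l[b] := by
    rw [List.getLast?_eq_getElem?, List.getElem?_eq_some_iff]
    refine ⟨by simp; omega, ?_⟩
    simp only [List.getElem_take, List.getElem_drop, List.length_take, List.length_drop]
    congr 1; omega
  have e₅ : (l.drop (b + 1)).head? = some l[b + 1] := by simp [List.head?_drop]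
  have e₆ : (l.drop (b + 1)).getLast? = some l[l.length - 1] := by
    rw [List.getLast?_eq_getElem?, List.getElem?_eq_some_iff]
    refine ⟨by simp; omega, ?_⟩
    simp only [List.getElem_drop, List.length_drop]
    congr 1; omega
  refine ⟨_, h'.reverse_append_append_reverse ?_ ?_ ?_ ?_ ?_ ?_⟩
  · exact fun h => by simp [h] at e₃
  · simpa [e₁, e₃] using h₁
  · simpa [e₄, e₆] using h₂.symm
  · simpa [e₂, e₅] using h₃
  · exact fun h => by simp [h] at e₁
  · exact fun h => by simp [h] at e₅

lemma IsSpanningPath.exists_isSpanningCycle_of_lt {l : List V} (h : H.IsSpanningPath l) {a b : ℕ}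
    (hab : b < a) (ha : a + 1 < l.length) (h₁ : H.Adj l[0] l[a])
    (h₂ : H.Adj l[l.length - 1] l[b]) (h₃ : H.Adj l[b + 1] l[a + 1]) :
    ∃ l', H.IsSpanningCycle l' := by
  have hl : l = l.take (b + 1) ++ ((l.drop (b + 1)).take (a - b) ++ l.drop (a + 1)) := by
    have : l.drop (a + 1) = (l.drop (b + 1)).drop (a - b) := by
      rw [List.drop_drop]; congr 1; omega
    rw [this, List.take_append_drop, List.take_append_drop]
  have h' := h
  rw [hl] at h'
  have e₁ : (l.take (b + 1)).head? = some l[0] := by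
    rw [List.head?_take, if_neg (by omega), List.head?_eq_getElem?, List.getElem?_eq_getElem]
  have e₂ : (l.take (b + 1)).getLast? = some l[b] := by
    rw [List.getLast?_eq_getElem?, List.getElem?_eq_some_iff]
    refine ⟨by simp; omega, ?_⟩
    simp only [List.getElem_take, List.length_take]
    congr 1; omega
  have e₃ : ((l.drop (b + 1)).take (a - b)).head? = some l[b + 1] := by
    simp [List.head?_take, List.head?_drop]
    omega
  have e₄ : ((l.drop (b + 1)).take (a - b)).getLast? = some l[a] := by
    rw [List.getLast?_eq_getElem?, List.getElem?_eq_some_iff]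
    refine ⟨by simp; omega, ?_⟩
    simp only [List.getElem_take, List.getElem_drop, List.length_take, List.length_drop]
    congr 1; omega
  have e₅ : (l.drop (a + 1)).head? = some l[a + 1] := by simp [List.head?_drop]
  have e₆ : (l.drop (a + 1)).getLast? = some l[l.length - 1] := by
    rw [List.getLast?_eq_getElem?, List.getElem?_eq_some_iff]
    refine ⟨by simp; omega, ?_⟩
    simp only [List.getElem_drop, List.length_drop]
    congr 1; omega
  refine ⟨_, h'.append_reverse_append ?_ ?_ ?_ ?_ ?_ ?_⟩
  · simpa [e₂, e₆] using h₂.symm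
  · simpa [e₃, e₅] using h₃.symm
  · simpa [e₄, e₁] using h₁.symm
  · exact fun h => by simp [h] at e₁
  · exact fun h => by simp [h] at e₃
  · exact fun h => by simp [h] at e₅

end Rotation

lemma exists_card_filter_le_and_card_filter_ge (A B : Finset ℕ) {s t : ℕ} (hs : 0 < s) (ht : 0 < t)
    (hA : s + t ≤ A.card + 1) (hB : s + t ≤ B.card + 1) :
    ∃ i, (s ≤ {a ∈ A | a ≤ i}.card ∧ t ≤ {b ∈ B | i ≤ b}.card) ∨
      (s ≤ {b ∈ B | b < i}.card ∧ t ≤ {a ∈ A | i ≤ a}.card) := by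
  have hsplit (C : Finset ℕ) (i : ℕ) : {c ∈ C | c < i}.card + {c ∈ C | i ≤ c}.card = C.card := by
    simpa only [not_lt] using C.card_filter_add_card_filter_not (· < i)
  have hex : ∃ i, s ≤ {a ∈ A | a ≤ i}.card := by
    refine ⟨A.sup id, ?_⟩
    rw [Finset.filter_true_of_mem fun a ha => by simpa using Finset.le_sup (f := id) ha]
    omega
  classical
  obtain ⟨i, hi, hmin⟩ : ∃ i, s ≤ {a ∈ A | a ≤ i}.card ∧ ∀ j < i, ¬ s ≤ {a ∈ A | a ≤ j}.card :=
    ⟨Nat.find hex, Nat.find_spec hex, fun j => Nat.find_min hex⟩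
  have hlt : {a ∈ A | a < i}.card < s := by
    rcases i with _ | j
    · simpa using hs
    · simpa only [Nat.lt_succ_iff, not_le] using hmin j j.lt_succ_self
  have h₁ := hsplit A i
  have h₂ := hsplit B i
  refine ⟨i, ?_⟩
  by_cases hb : t ≤ {b ∈ B | i ≤ b}.card
  · exact Or.inl ⟨hi, hb⟩
  · exact Or.inr ⟨by omega, by omega⟩

lemma IsSpanningPath.exists_isSpanningCycle {H : SimpleGraph V} {l : List V}
    (h : H.IsSpanningPath l) {s t : ℕ} (hs : 0 < s) (ht : 0 < t) (hole : ¬ H.HasBipartiteHole s t)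
    {x y : V} (hx : x ∈ l.head?) (hy : y ∈ l.getLast?) (hxy : ¬ H.Adj x y) {A B : Finset V}
    (hA : ∀ a ∈ A, H.Adj x a) (hB : ∀ b ∈ B, H.Adj y b) (hAc : s + t ≤ A.card + 1)
    (hBc : s + t ≤ B.card + 1) : ∃ l', H.IsSpanningCycle l' := by
  classical
  have hne : l ≠ [] := by rintro rfl; simp at hx
  have hpos : 0 < l.length := List.length_pos_iff.2 hne
  obtain rfl : l[0] = x := by simpa [List.head?_eq_getElem?, hpos] using hx
  obtain rfl : l[l.length - 1] = y := by
    simpa [List.getLast?_eq_getElem?, hpos] using hy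
  have hidx (v : V) : l.idxOf v < l.length := List.idxOf_lt_length_iff.2 (h.mem v)
  have hinj : Function.Injective (fun v => l.idxOf v) := fun u v huv =>
    (List.idxOf_inj (h.mem u)).1 huv
  have hcard (C : Finset V) : (C.image (fun v => l.idxOf v)).card = C.card :=
    Finset.card_image_of_injective _ hinj
  have hA' : ∀ a ∈ A.image (fun v => l.idxOf v), 1 ≤ a ∧ a + 1 < l.length ∧
      ∃ ha : a < l.length, H.Adj l[0] l[a] := by
    simp only [Finset.mem_image, forall_exists_index, and_imp]
    rintro _ v hv rfl
    have hvA := hA v hv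
    have e : l[l.idxOf v]'(hidx v) = v := List.getElem_idxOf _
    refine ⟨?_, ?_, hidx v, by rwa [e]⟩
    · rw [Nat.one_le_iff_ne_zero]
      intro h0
      simp only [h0] at e
      exact hvA.ne e
    · by_contra hlt
      have h0 : l.idxOf v = l.length - 1 := by have := hidx v; omega
      simp only [h0] at e
      exact hxy (e ▸ hvA)
  have hB' : ∀ b ∈ B.image (fun v => l.idxOf v), b + 1 < l.length ∧
      ∃ hb : b < l.length, H.Adj l[l.length - 1] l[b] := by
    simp only [Finset.mem_image, forall_exists_index, and_imp]
    rintro _ v hv rfl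
    have hvB := hB v hv
    have e : l[l.idxOf v]'(hidx v) = v := List.getElem_idxOf _
    refine ⟨?_, hidx v, by rwa [e]⟩
    by_contra hlt
    have h0 : l.idxOf v = l.length - 1 := by have := hidx v; omega
    simp only [h0] at e
    exact hvB.ne e
  obtain ⟨i, ⟨h₁, h₂⟩ | ⟨h₁, h₂⟩⟩ := exists_card_filter_le_and_card_filter_ge
    (A.image (fun v => l.idxOf v)) (B.image (fun v => l.idxOf v)) hs ht
    (by rwa [hcard]) (by rwa [hcard])
  all_goals
    by_contra hcyc
    apply hole
    have himg (C : Finset ℕ) (f : ℕ → ℕ) (hf : Set.InjOn f C) (hC : ∀ c ∈ C, f c < l.length) :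
        (C.image fun c => l.getD (f c) l[0]).card = C.card := by
      refine Finset.card_image_of_injOn fun c hc d hd hcd => hf hc hd ?_
      have h₁ := hC c hc
      have h₂ := hC d hd
      simp only [List.getD_eq_getElem _ _ h₁, List.getD_eq_getElem _ _ h₂] at hcd
      exact (h.nodup.getElem_inj_iff).1 hcd
    generalize A.image (fun v => l.idxOf v) = A' at *
    generalize B.image (fun v => l.idxOf v) = B' at *
  · refine .of_le_card (S := {a ∈ A' | a ≤ i}.image fun a => l.getD (a - 1) l[0])
      (T := {b ∈ B' | i ≤ b}.image fun b => l.getD (b + 1) l[0]) ?_ ?_ ?_ ?_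
    · simp only [Finset.disjoint_left, Finset.mem_image, Finset.mem_filter]
      rintro _ ⟨a, ⟨ha, hai⟩, rfl⟩ ⟨b, ⟨hb, hib⟩, hab⟩
      obtain ⟨ha₁, ha₂, -⟩ := hA' a ha
      obtain ⟨hb₁, -⟩ := hB' b hb
      rw [List.getD_eq_getElem _ _ hb₁, List.getD_eq_getElem _ _ (by omega : a - 1 < l.length),
        h.nodup.getElem_inj_iff] at hab
      omega
    · rwa [himg _ (fun a => a - 1)]
      · intro a ha b hb (hab : a - 1 = b - 1)
        have := (hA' a (Finset.mem_filter.1 ha).1).1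
        have := (hA' b (Finset.mem_filter.1 hb).1).1
        omega
      · intro a ha
        have := (hA' a (Finset.mem_filter.1 ha).1).2.1
        omega
    · rwa [himg _ (fun b => b + 1) (by intro a _ b _; simp)]
      intro b hb
      exact (hB' b (Finset.mem_filter.1 hb).1).1
    · simp only [Finset.mem_image, Finset.mem_filter]
      rintro _ ⟨a, ⟨ha, hai⟩, rfl⟩ _ ⟨b, ⟨hb, hib⟩, rfl⟩ hab
      obtain ⟨ha₁, ha₂, _, ha₃⟩ := hA' a ha
      obtain ⟨hb₁, _, hb₂⟩ := hB' b hb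
      rw [List.getD_eq_getElem _ _ hb₁,
        List.getD_eq_getElem _ _ (by omega : a - 1 < l.length)] at hab
      exact hcyc (h.exists_isSpanningCycle_of_le ha₁ (hai.trans hib) hb₁ ha₃ hb₂ hab)
  · refine .of_le_card (S := {b ∈ B' | b < i}.image fun b => l.getD (b + 1) l[0])
      (T := {a ∈ A' | i ≤ a}.image fun a => l.getD (a + 1) l[0]) ?_ ?_ ?_ ?_
    · simp only [Finset.disjoint_left, Finset.mem_image, Finset.mem_filter]
      rintro _ ⟨b, ⟨hb, hib⟩, rfl⟩ ⟨a, ⟨ha, hai⟩, hab⟩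
      obtain ⟨ha₁, ha₂, -⟩ := hA' a ha
      obtain ⟨hb₁, -⟩ := hB' b hb
      rw [List.getD_eq_getElem _ _ hb₁, List.getD_eq_getElem _ _ ha₂,
        h.nodup.getElem_inj_iff] at hab
      omega
    · rwa [himg _ (fun b => b + 1) (by intro a _ b _; simp)]
      intro b hb
      exact (hB' b (Finset.mem_filter.1 hb).1).1
    · rwa [himg _ (fun b => b + 1) (by intro a _ b _; simp)]
      intro a ha
      exact (hA' a (Finset.mem_filter.1 ha).1).2.1
    · simp only [Finset.mem_image, Finset.mem_filter]
      rintro _ ⟨b, ⟨hb, hib⟩, rfl⟩ _ ⟨a, ⟨ha, hai⟩, rfl⟩ hab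
      obtain ⟨ha₁, ha₂, _, ha₃⟩ := hA' a ha
      obtain ⟨hb₁, _, hb₂⟩ := hB' b hb
      rw [List.getD_eq_getElem _ _ hb₁, List.getD_eq_getElem _ _ ha₂] at hab
      exact hcyc (h.exists_isSpanningCycle_of_lt (hib.trans_le hai) ha₂ ha₃ hb₂ hab)

lemma IsSpanningCycle.rotate {H : SimpleGraph V} {P Q : List V} (h : H.IsSpanningCycle (P ++ Q))
    (hP : P ≠ []) (hQ : Q ≠ []) : H.IsSpanningCycle (Q ++ P) := by
  obtain ⟨⟨hc, hn, hm⟩, hcl⟩ := h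
  rw [List.isChain_append] at hc
  rw [List.getLast?_append_of_ne_nil _ hQ, List.head?_append_of_ne_nil _ hP] at hcl
  refine ⟨⟨List.isChain_append.2 ⟨hc.2.1, hc.1, hcl⟩, List.perm_append_comm.nodup_iff.1 hn,
    fun v => List.perm_append_comm.mem_iff.1 (hm v)⟩, ?_⟩
  rw [List.getLast?_append_of_ne_nil _ hP, List.head?_append_of_ne_nil _ hQ]
  exact hc.2.2

lemma IsSpanningCycle.exists_isSpanningPath [Fintype V] (hV : 3 ≤ Fintype.card V)
    {H : SimpleGraph V} {x y : V} {l : List V} (hl : (H ⊔ edge x y).IsSpanningCycle l)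
    (hH : ¬ H.IsSpanningCycle l) :
    ∃ l', H.IsSpanningPath l' ∧
      (x ∈ l'.head? ∧ y ∈ l'.getLast? ∨ y ∈ l'.head? ∧ x ∈ l'.getLast?) := by
  obtain ⟨l', hl', v, hv, u, hu, hvu⟩ : ∃ l', (H ⊔ edge x y).IsSpanningCycle l' ∧
      ∃ v ∈ l'.getLast?, ∃ u ∈ l'.head?, ¬ H.Adj v u := by
    by_cases hc : l.IsChain H.Adj
    · by_contra! hno
      exact hH ⟨⟨hc, hl.nodup, hl.mem⟩, hno l hl⟩
    · rw [List.isChain_iff_forall_rel_of_append_cons_cons] at hc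
      push Not at hc
      obtain ⟨a, b, l₁, l₂, rfl, hab⟩ := hc
      refine ⟨b :: l₂ ++ (l₁ ++ [a]), ?_, a, ?_, b, by simp, hab⟩
      swap
      · rw [← List.append_assoc, List.getLast?_append]
        simp
      refine IsSpanningCycle.rotate ?_ (by simp) (by simp)
      simpa using hl
  have hlen := hl'.length_eq
  obtain ⟨m, rfl⟩ : ∃ m, l' = u :: m ++ [v] := by
    rcases l' with _ | ⟨a, t⟩
    · simp at hu
    rcases List.eq_nil_or_concat t with rfl | ⟨m, b, rfl⟩
    · simp at hlen
      omega
    · refine ⟨m, ?_⟩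
      simp only [List.head?_cons, Option.mem_some_iff] at hu
      simp only [List.concat_eq_append, ← List.cons_append, List.getLast?_append,
        List.getLast?_singleton, Option.some_or, Option.mem_some_iff] at hv
      simp [hu, hv]
  have hends : v = x ∧ u = y ∨ v = y ∧ u = x := by
    have := hl'.closes v hv u hu
    rw [sup_adj, edge_adj] at this
    tauto
  have hadj : ∀ a b, ¬ (a = u ∧ b = v) → ¬ (a = v ∧ b = u) → (H ⊔ edge x y).Adj a b →
      H.Adj a b := by
    intro a b h₁ h₂ h₃
    rw [sup_adj, edge_adj] at h₃
    rcases hends with ⟨rfl, rfl⟩ | ⟨rfl, rfl⟩ <;> tauto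
  obtain ⟨hc, hn, hm⟩ := hl'.toIsSpanningPath
  refine ⟨u :: m ++ [v], ⟨?_, hn, hm⟩, ?_⟩
  · rcases m with _ | ⟨w, m⟩
    · simp at hlen
      omega
    simp only [List.cons_append, List.isChain_cons_cons] at hc ⊢
    simp only [List.cons_append, List.nodup_cons, List.mem_cons, List.mem_append] at hn
    refine ⟨hadj _ _ (by grind) (by grind) hc.1, hc.2.imp_of_mem_imp fun a b ha hb hab => ?_⟩
    refine hadj a b ?_ ?_ hab
    · rintro ⟨rfl, rfl⟩
      simp at ha
      grind
    · rintro ⟨rfl, rfl⟩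
      simp at hb
      grind
  · rcases hends with ⟨rfl, rfl⟩ | ⟨rfl, rfl⟩
    · exact Or.inr ⟨hu, hv⟩
    · exact Or.inl ⟨hu, hv⟩

lemma TwoConnected.exists_adj_of_mem_of_notMem [Fintype V] {G : SimpleGraph V}
    (hG : G.TwoConnected) (S : Set V) {v a b : V} (ha : a ∈ S) (hb : b ∉ S) (hav : a ≠ v)
    (hbv : b ≠ v) : ∃ c ∈ S, ∃ d ∉ S, c ≠ v ∧ d ≠ v ∧ G.Adj c d := by
  obtain ⟨p⟩ := (hG.2 v).preconnected ⟨a, hav⟩ ⟨b, hbv⟩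
  obtain ⟨d, -, h₁, h₂⟩ := p.exists_boundary_dart (Subtype.val ⁻¹' S) ha hb
  exact ⟨d.fst, h₁, d.snd, h₂, d.fst.2, d.snd.2, d.adj⟩

lemma TwoConnected.exists_adj_adj [Fintype V] {G : SimpleGraph V}
    (hG : G.TwoConnected) (C : Set V) {a b₀ b₁ : V} (ha : a ∈ C) (hb₀ : b₀ ∉ C) (hb₁ : b₁ ∉ C)
    (hb : b₀ ≠ b₁) : ∃ c ∈ C, ∃ c' ∈ C, ∃ b ∉ C, ∃ b' ∉ C, b ≠ b' ∧ G.Adj c b ∧ G.Adj c' b' ∧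
      (c = c' → C ⊆ {c}) := by
  obtain ⟨c, hc, b, hbC, -, -, hcb⟩ :=
    hG.exists_adj_of_mem_of_notMem C ha hb₁ (v := b₀) (by grind) (by grind)
  obtain ⟨r, hr, hrb⟩ : ∃ r ∉ C, r ≠ b := by
    by_cases h : b₀ = b
    · exact ⟨b₁, hb₁, by grind⟩
    · exact ⟨b₀, hb₀, h⟩
  obtain ⟨c₁, hc₁, d₁, hd₁, -, hdb, hcd₁⟩ :=
    hG.exists_adj_of_mem_of_notMem C hc hr (v := b) (by grind) hrb
  by_cases hcc : c = c₁ → C ⊆ {c}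
  · exact ⟨c, hc, c₁, hc₁, b, hbC, d₁, hd₁, hdb.symm, hcb, hcd₁, hcc⟩
  push Not at hcc
  obtain ⟨rfl, hcc⟩ := hcc
  obtain ⟨e, he, hec⟩ := Set.not_subset.1 hcc
  obtain ⟨c₂, hc₂, d₂, hd₂, hne, -, hcd₂⟩ :=
    hG.exists_adj_of_mem_of_notMem C he hr (v := c) hec (by grind)
  by_cases h : b = d₂
  · subst h
    exact ⟨c, hc, c₂, hc₂, d₁, hd₁, b, hd₂, hdb, hcd₁, hcd₂, fun h => absurd h.symm hne⟩
  · exact ⟨c, hc, c₂, hc₂, b, hbC, d₂, hd₂, h, hcb, hcd₂, fun h => absurd h.symm hne⟩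

lemma exists_isChain_of_isClique [Finite V] {H : SimpleGraph V} {C : Set V} (hC : H.IsClique C)
    {c c' : V} (hc : c ∈ C) (hc' : c' ∈ C) (h : c = c' → C ⊆ {c}) :
    ∃ l : List V, l.IsChain H.Adj ∧ l.Nodup ∧ (∀ v, v ∈ l ↔ v ∈ C) ∧ l.head? = some c ∧
      l.getLast? = some c' := by
  classical
  have hch (l : List V) (hn : l.Nodup) (hl : ∀ v, v ∈ l ↔ v ∈ C) : l.IsChain H.Adj :=
    (hn.imp_of_mem fun ha hb hab => hC ((hl _).1 ha) ((hl _).1 hb) hab).isChain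
  by_cases hcc : c = c'
  · subst hcc
    have := h rfl
    refine ⟨[c], by simp, by simp, fun v => ?_, rfl, rfl⟩
    simp only [List.mem_singleton]
    exact ⟨fun h => h ▸ hc, fun h => this h⟩
  · set t := ((Set.toFinite C).toFinset \ {c, c'}).toList with ht
    have hmem (v : V) : v ∈ t ↔ v ∈ C ∧ v ≠ c ∧ v ≠ c' := by simp [ht]
    have hn : (c :: t ++ [c']).Nodup := by
      have : t.Nodup := Finset.nodup_toList _
      simp only [List.cons_append, List.nodup_cons, List.nodup_append, List.mem_append, hmem,
        List.mem_singleton]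
      simp [this, hcc]
    have hm (v : V) : v ∈ c :: t ++ [c'] ↔ v ∈ C := by
      simp only [List.cons_append, List.mem_cons, List.mem_append, hmem]
      grind
    exact ⟨_, hch _ hn hm, hn, hm, by simp, by rw [List.getLast?_append]; simp⟩

lemma TwoConnected.exists_isSpanningCycle_of_subset_singleton [Fintype V] {G : SimpleGraph V}
    (hG : G.TwoConnected) {v : V}
    (hL : ∀ x y z, x ≠ v → y ≠ v → x ≠ y → G.Adj x z → G.Adj z y → G.Adj x y) :
    ∃ l, G.IsSpanningCycle l := by
  have hclique : G.IsClique {v}ᶜ := by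
    intro x hx y hy hxy
    by_contra hadj
    obtain ⟨c, hc, d, hd, hcv, hdv, hcd⟩ :=
      hG.exists_adj_of_mem_of_notMem {z | z = x ∨ z ≠ v ∧ G.Adj x z} (v := v) (a := x) (b := y)
        (Or.inl rfl) (by simp_all [eq_comm]) hx hy
    refine hd ?_
    rcases hc with rfl | ⟨-, hc⟩
    · exact Or.inr ⟨hdv, hcd⟩
    · by_cases h : d = x
      · exact Or.inl h
      · exact Or.inr ⟨hdv, hL x d c hx hdv (Ne.symm h) hc hcd⟩
  obtain ⟨b₀, b₁, hb₀, hb₁, hb⟩ : ∃ b₀ b₁ : V, b₀ ≠ v ∧ b₁ ≠ v ∧ b₀ ≠ b₁ := by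
    classical
    have : 1 < (Finset.univ.erase v).card := by
      rw [Finset.card_erase_of_mem (Finset.mem_univ v), Finset.card_univ]
      have := hG.1
      omega
    obtain ⟨b₀, h₀, b₁, h₁, h⟩ := Finset.one_lt_card.1 this
    exact ⟨b₀, b₁, by simpa using h₀, by simpa using h₁, h⟩
  obtain ⟨c, rfl, c', rfl, b, hb, b', hb', hne, hcb, hcb', -⟩ :=
    hG.exists_adj_adj {v} (a := v) rfl hb₀ hb₁ hb
  obtain ⟨M, hM, hMn, hMm, hMh, hMl⟩ :=
    exists_isChain_of_isClique hclique hb hb' (fun h => absurd h hne)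
  refine ⟨c' :: M, ⟨?_, ?_, ?_⟩, ?_⟩
  · rw [List.isChain_cons]
    exact ⟨by simp [hMh, hcb], hM⟩
  · exact List.nodup_cons.2 ⟨by simp [hMm], hMn⟩
  · intro w
    by_cases h : w = c' <;> simp [h, hMm]
  · simp [List.getLast?_cons, hMl, hcb'.symm]

/-- The list `l` is a path of `H` with both ends in `B` that contains every vertex outside `B`
having a `G`-neighbour on `l`. -/
structure IsClosedSegment (G H : SimpleGraph V) (B : Set V) (l : List V) : Prop where
  isChain : l.IsChain H.Adj
  nodup : l.Nodup
  head_mem : ∀ v ∈ l.head?, v ∈ B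
  getLast_mem : ∀ v ∈ l.getLast?, v ∈ B
  closed : ∀ v ∈ l, ∀ w ∉ B, G.Adj v w → w ∈ l

lemma IsClosedSegment.append {G H : SimpleGraph V} {B : Set V} {l P : List V}
    (hB : H.IsClique B) (hl : G.IsClosedSegment H B l) (hPc : P.IsChain H.Adj) (hPn : P.Nodup)
    (hPh : ∀ v ∈ P.head?, v ∈ B) (hPl : ∀ v ∈ P.getLast?, v ∈ B)
    (hP : ∀ v ∈ P, ∀ w ∉ B, G.Adj v w → w ∈ l ++ P) (hd : l.Disjoint P) :
    G.IsClosedSegment H B (l ++ P) where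
  isChain := by
    refine List.isChain_append.2 ⟨hl.isChain, hPc, fun x hx y hy =>
      hB (hl.getLast_mem x hx) (hPh y hy) ?_⟩
    rintro rfl
    exact hd (List.mem_of_getLast? hx) (List.mem_of_head? hy)
  nodup := hl.nodup.append hPn hd
  head_mem := by
    intro v hv
    rw [List.head?_append, Option.mem_def, Option.or_eq_some_iff] at hv
    exact hv.elim (hl.head_mem v) fun h => hPh v h.2
  getLast_mem := by
    intro v hv
    rw [List.getLast?_append, Option.mem_def, Option.or_eq_some_iff] at hv
    exact hv.elim (hPl v) fun h => hl.getLast_mem v h.2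
  closed := by
    intro v hv w hw hvw
    rcases List.mem_append.1 hv with hv | hv
    · exact List.mem_append_left _ (hl.closed v hv w hw hvw)
    · exact hP v hv w hw hvw

lemma IsClosedSegment.exists_length_lt [Fintype V] {G H : SimpleGraph V} {B : Set V}
    (hG : G.TwoConnected)
    (hL : ∀ x y z, x ∉ B → y ∉ B → x ≠ y → G.Adj x z → G.Adj z y → G.Adj x y)
    (hGH : G ≤ H) (hB : H.IsClique B) (hBn : B.Nontrivial) {l : List V}
    (hl : G.IsClosedSegment H B l) {x : V} (hxB : x ∉ B) (hxl : x ∉ l) :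
    ∃ l', G.IsClosedSegment H B l' ∧ l.length < l'.length := by
  set C : Set V := {w | w ∉ B ∧ (w = x ∨ G.Adj w x)}
  have hC : G.IsClique C := by
    rintro a ⟨haB, ha⟩ b ⟨hbB, hb⟩ hab
    rcases ha with rfl | ha
    · rcases hb with rfl | hb
      · exact absurd rfl hab
      · exact hb.symm
    · rcases hb with rfl | hb
      · exact ha
      · exact hL a b x haB hbB hab ha hb.symm
  have hxC : x ∈ C := ⟨hxB, Or.inl rfl⟩
  have hCl : ∀ c ∈ C, c ∉ l := by
    rintro c ⟨hcB, rfl | hc⟩ hcl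
    · exact hxl hcl
    · exact hxl (hl.closed c hcl x hxB hc)
  have hCadj : ∀ c ∈ C, ∀ w ∉ B, G.Adj c w → w ∈ C := by
    rintro c ⟨hcB, hc⟩ w hw hcw
    refine ⟨hw, ?_⟩
    by_cases hwx : w = x
    · exact Or.inl hwx
    · rcases hc with rfl | hc
      · exact Or.inr hcw.symm
      · exact Or.inr (hL w x c hw hxB hwx hcw.symm hc)
  have hCadj₂ : ∀ c ∈ C, ∀ b, ∀ w ∉ B, G.Adj c b → G.Adj b w → w ∈ C := by
    intro c hc b w hw hcb hbw
    by_cases hcw : c = w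
    · exact hcw ▸ hc
    · exact hCadj c hc w hw (hL c w b hc.1 hw hcw hcb hbw)
  obtain ⟨b₀, hb₀, b₁, hb₁, hb⟩ := hBn
  obtain ⟨c, hc, c', hc', b, hbC, b', hb'C, hbb, hcb, hcb', hcc⟩ :=
    hG.exists_adj_adj C hxC (fun h => h.1 hb₀) (fun h => h.1 hb₁) hb
  have hbB : b ∈ B := by
    by_contra h
    exact hbC (hCadj c hc b h hcb)
  have hbB' : b' ∈ B := by
    by_contra h
    exact hb'C (hCadj c' hc' b' h hcb')
  have hbl : b ∉ l := fun h => hCl c hc (hl.closed b h c hc.1 hcb.symm)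
  have hbl' : b' ∉ l := fun h => hCl c' hc' (hl.closed b' h c' hc'.1 hcb'.symm)
  obtain ⟨M, hM, hMn, hMm, hMh, hMl⟩ :=
    exists_isChain_of_isClique (H := H) (fun u hu w hw h => hGH (hC hu hw h)) hc hc' hcc
  refine ⟨l ++ (b :: (M ++ [b'])), hl.append hB ?_ ?_ ?_ ?_ ?_ ?_, by simp⟩
  · rw [List.isChain_cons, List.isChain_append]
    simp [hMh, hMl, hM, hGH hcb.symm, hGH hcb']
  · simp only [List.nodup_cons, List.nodup_append, List.mem_append, hMm, List.mem_singleton]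
    simp only [List.nodup_nil, List.not_mem_nil]
    grind
  · simpa using hbB
  · rw [← List.cons_append, List.getLast?_append]
    simpa using hbB'
  · intro v hv w hw hvw
    have : w ∈ C := by
      simp only [List.mem_cons, List.mem_append, hMm, List.not_mem_nil, or_false] at hv
      rcases hv with rfl | hv | rfl
      · exact hCadj₂ c hc v w hw hcb hvw
      · exact hCadj v hv w hw hvw
      · exact hCadj₂ c' hc' v w hw hcb' hvw
    simp [hMm, this]
  · intro v hvl hv
    simp only [List.mem_cons, List.mem_append, hMm, List.not_mem_nil, or_false] at hv
    rcases hv with rfl | hv | rfl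
    · exact hbl hvl
    · exact hCl v hv hvl
    · exact hbl' hvl

lemma TwoConnected.exists_isSpanningCycle [Fintype V] {G H : SimpleGraph V} {B : Set V}
    (hG : G.TwoConnected)
    (hL : ∀ x y z, x ∉ B → y ∉ B → x ≠ y → G.Adj x z → G.Adj z y → G.Adj x y)
    (hGH : G ≤ H) (hB : H.IsClique B) : ∃ l, H.IsSpanningCycle l := by
  by_cases hBn : B.Nontrivial
  · obtain ⟨l, hl, hmax⟩ : ∃ l, G.IsClosedSegment H B l ∧
        ∀ l', G.IsClosedSegment H B l' → l'.length ≤ l.length := by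
      let N : Set ℕ := {n | ∃ l, G.IsClosedSegment H B l ∧ l.length = n}
      have hbdd : BddAbove N := by
        refine ⟨Fintype.card V, ?_⟩
        rintro _ ⟨l, hl, rfl⟩
        exact hl.nodup.length_le_card
      obtain ⟨l, hl, hlen⟩ : sSup N ∈ N :=
        Nat.sSup_mem ⟨0, [], ⟨by simp, by simp, by simp, by simp, by simp⟩, rfl⟩ hbdd
      exact ⟨l, hl, fun l' hl' => hlen ▸ le_csSup hbdd ⟨l', hl', rfl⟩⟩
    have hout : ∀ x ∉ B, x ∈ l := by
      intro x hxB
      by_contra hxl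
      obtain ⟨l', hl', hlt⟩ := hl.exists_length_lt hG hL hGH hB hBn hxB hxl
      exact absurd (hmax l' hl') (by omega)
    have hmem : ∀ x, x ∈ l := by
      intro x
      by_contra hxl
      have hxB : x ∈ B := by
        by_contra h
        exact hxl (hout x h)
      have := hmax (l ++ [x]) (hl.append hB (by simp) (by simp) (by simpa) (by simpa)
        (fun _ _ w hw _ => List.mem_append_left _ (hout w hw)) (by simpa using hxl))
      simp at this
    refine ⟨l, ⟨hl.isChain, hl.nodup, hmem⟩, fun x hx y hy =>
      hB (hl.getLast_mem x hx) (hl.head_mem y hy) ?_⟩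
    rintro rfl
    obtain ⟨b₀, -, b₁, -, hb⟩ := hBn
    obtain ⟨m, rfl⟩ := List.head?_eq_some_iff.1 hy
    rcases List.eq_nil_or_concat m with rfl | ⟨m, z, rfl⟩
    · have h₀ := hmem b₀
      have h₁ := hmem b₁
      simp only [List.mem_singleton] at h₀ h₁
      exact hb (h₀.trans h₁.symm)
    · have hn := hl.nodup
      rw [List.concat_eq_append, ← List.cons_append, List.getLast?_append] at hx
      simp_all
  · obtain ⟨v₀⟩ : Nonempty V := Fintype.card_pos_iff.1 (by have := hG.1; omega)
    obtain ⟨v, hv⟩ : ∃ v, B ⊆ {v} := by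
      rcases (Set.not_nontrivial_iff.1 hBn).eq_empty_or_singleton with rfl | ⟨v, rfl⟩
      · exact ⟨v₀, by simp⟩
      · exact ⟨v, subset_rfl⟩
    obtain ⟨l, hl⟩ := hG.exists_isSpanningCycle_of_subset_singleton (v := v) fun x y z hx hy =>
      hL x y z (fun h => hx (hv h)) (fun h => hy (hv h))
    exact ⟨l, ⟨hl.isChain.imp fun _ _ h => hGH h, hl.nodup, hl.mem⟩,
      fun x hx y hy => hGH (hl.closes x hx y hy)⟩

end SimpleGraph

theorem hamiltonian_of_max_degree_dist_two {V : Type*} [Fintype V] [DecidableEq V]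
    (G : SimpleGraph V) [DecidableRel G.Adj] (hG : G.TwoConnected)
    (h : ∀ x y : V, G.dist x y = 2 →
      G.bipartiteHoleNumber ≤ max (G.degree x) (G.degree y)) :
    G.IsHamiltonian := by
  by_contra hcon
  obtain ⟨s, t, hs, ht, hst, hole⟩ := G.exists_not_hasBipartiteHole
  obtain ⟨H, hH⟩ := Set.Finite.exists_maximal
    (s := {H : SimpleGraph V | G ≤ H ∧ ¬ ∃ l, H.IsSpanningCycle l}) (Set.toFinite _)
    ⟨G, le_rfl, fun ⟨l, hl⟩ => hcon (hl.isHamiltonian hG.1)⟩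
  obtain ⟨hGH, hno⟩ := hH.prop
  refine hno (hG.exists_isSpanningCycle (B := {v | G.bipartiteHoleNumber ≤ G.degree v})
    ?_ hGH ?_)
  · intro x y z hx hy hxy hxz hzy
    by_contra hadj
    have hdist : G.dist x y = 2 := by
      have h₁ := SimpleGraph.dist_le (.cons hxz (.cons hzy .nil))
      have h₂ : G.dist x y ≠ 1 := fun h' => hadj (SimpleGraph.dist_eq_one_iff_adj.1 h')
      have h₃ : G.dist x y ≠ 0 := by
        have hr : G.Reachable x y := hxz.reachable.trans hzy.reachable
        rwa [Ne, hr.dist_eq_zero_iff]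
      simp only [SimpleGraph.Walk.length_cons, SimpleGraph.Walk.length_nil] at h₁
      omega
    rcases le_max_iff.1 (h x y hdist) with h' | h'
    · exact hx h'
    · exact hy h'
  · intro x hx y hy hxy
    by_contra hadj
    obtain ⟨l, hl⟩ : ∃ l, (H ⊔ SimpleGraph.edge x y).IsSpanningCycle l := by
      by_contra hno'
      refine hadj (hH.le_of_ge ⟨hGH.trans le_sup_left, hno'⟩ le_sup_left ?_)
      simp [SimpleGraph.edge_adj, hxy]
    have hole' : ¬ H.HasBipartiteHole s t := fun h' => hole (h'.anti hGH)
    have hnbr (v : V) : ∀ a ∈ G.neighborFinset v, H.Adj v a := fun a ha =>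
      hGH ((G.mem_neighborFinset v a).1 ha)
    have hcard (v : V) (hv : G.bipartiteHoleNumber ≤ G.degree v) :
        s + t ≤ (G.neighborFinset v).card + 1 := by
      rw [SimpleGraph.card_neighborFinset_eq_degree]
      omega
    obtain ⟨l', hl', ⟨h₁, h₂⟩ | ⟨h₁, h₂⟩⟩ :=
      hl.exists_isSpanningPath hG.1 fun hl => hno ⟨l, hl⟩
    · exact hno (hl'.exists_isSpanningCycle hs ht hole' h₁ h₂ hadj (hnbr x) (hnbr y)
        (hcard x hx) (hcard y hy))
    · exact hno (hl'.exists_isSpanningCycle hs ht hole' h₁ h₂ (fun h' => hadj h'.symm)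
        (hnbr y) (hnbr x) (hcard y hy) (hcard x hx))
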